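/- Let L1 > 0, L2 > 0, M1, β1, κ0, γ2 be real numbers and let β2 be real with cos β2 ≠ 0 and cos β1 + κ0·M1·sin β1 ≠ 0. Then the function β ↦ f_{β2}(β1, β, κ0, γ2) is differentiable at β2 with derivative cos γ2·( sin β2·(sin β1 − κ0·M1·cos β1)/(L1·cos²β2·(cos β1 + κ0·M1·sin β1)) − 1/(cos²β2·L2) ). -/

import Mathlib

/-- Joint-angle kinematics function for joint angle β2. -/
noncomputable def fβ2 (L1 L2 M1 β1 β2 κ0 γ2 : ℝ) : ℝ :=
  Real.cos γ2 * (Real.sin β1 / L1 - (M1 / L1) * κ0 * Real.cos β1) /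
      (Real.cos β2 * (M1 * κ0 * Real.sin β1 + Real.cos β1)) -
    Real.sin (β2 - γ2) / (L2 * Real.cos β2)

/-- Joint-angle kinematics function for joint angle β1. -/
noncomputable def fβ1 (L1 M1 β1 β2 κ0 γ2 : ℝ) : ℝ :=
  Real.cos γ2 * (κ0 - Real.sin β1 / L1 + (M1 / L1) * κ0 * Real.cos β1) /
    (Real.cos β2 * (M1 * κ0 * Real.sin β1 + Real.cos β1))

/-- Jacobian entry `a₃₃(s)`: partial derivative of `fβ2` with respect to `β2`. -/
theorem stmt_10 (L1 L2 M1 β1 κ0 γ2 β2 : ℝ) (hL1 : 0 < L1) (hL2 : 0 < L2)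
    (hβ2 : Real.cos β2 ≠ 0) (hβ1 : Real.cos β1 + κ0 * M1 * Real.sin β1 ≠ 0) :
    HasDerivAt (fun β : ℝ => fβ2 L1 L2 M1 β1 β κ0 γ2)
      (Real.cos γ2 *
        (Real.sin β2 * (Real.sin β1 - κ0 * M1 * Real.cos β1) /
            (L1 * Real.cos β2 ^ 2 * (Real.cos β1 + κ0 * M1 * Real.sin β1)) -
          1 / (Real.cos β2 ^ 2 * L2))) β2 := by
  have hD : M1 * κ0 * Real.sin β1 + Real.cos β1 ≠ 0 := by
    convert hβ1 using 1
    ring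
  have hcos := Real.hasDerivAt_cos β2
  have hsin : HasDerivAt (fun β : ℝ => Real.sin (β - γ2)) (Real.cos (β2 - γ2)) β2 := by
    simpa using ((hasDerivAt_id β2).sub_const γ2).sin
  have hfirst := (hasDerivAt_const β2
    (Real.cos γ2 * (Real.sin β1 / L1 - (M1 / L1) * κ0 * Real.cos β1))).fun_div
    (hcos.mul_const (M1 * κ0 * Real.sin β1 + Real.cos β1)) (mul_ne_zero hβ2 hD)
  have hsecond := hsin.fun_div (hcos.const_mul L2) (mul_ne_zero hL2.ne' hβ2)
  have hγ2 : Real.cos γ2 =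
      Real.cos (β2 - γ2) * Real.cos β2 + Real.sin (β2 - γ2) * Real.sin β2 := by
    rw [← Real.cos_sub, ← Real.cos_neg]
    congr 1
    ring
  unfold fβ2
  refine (hfirst.fun_sub hsecond).congr_deriv ?_
  rw [show Real.cos β1 + κ0 * M1 * Real.sin β1 = M1 * κ0 * Real.sin β1 + Real.cos β1 by ring]
  generalize M1 * κ0 * Real.sin β1 + Real.cos β1 = D at hD ⊢
  field_simp
  linear_combination L1 * D * hγ2
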